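/- Let s be an integer, 0 < s < d, and let μ be an s-rectifiable measure of class C^{1,α} on ℝ^d (α ∈ (0,1]) with 0 < Θ^s_*(μ,ξ₀) ≤ Θ^{*s}(μ,ξ₀) < ∞ at some point ξ₀. If μ admits (p,q) Fourier restriction, then q ≤ s·p'/(d + α(d−s)). -/

import Mathlib

open MeasureTheory Metric Filter
open scoped FourierTransform ENNReal NNReal SchwartzMap

noncomputable section

abbrev Euc (d : ℕ) := EuclideanSpace ℝ (Fin d)

/-- `(p,q)` Fourier restriction with constant `C`. -/
def HasRestriction {d : ℕ} (μ : Measure (Euc d)) (p q C : ℝ) : Prop :=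
  ∀ f : 𝓢(Euc d, ℂ),
    eLpNorm (𝓕 (f : Euc d → ℂ)) (ENNReal.ofReal q) μ ≤
      ENNReal.ofReal C * eLpNorm (f : Euc d → ℂ) (ENNReal.ofReal p) volume

/-- The upper `s`-density of `μ` at `x`. -/
def upperDensity {d : ℕ} (μ : Measure (Euc d)) (s : ℝ) (x : Euc d) : ℝ≥0∞ :=
  limsup (fun r : ℝ => μ (closedBall x r) / ENNReal.ofReal (r ^ s)) (nhdsWithin 0 (Set.Ioi 0))

/-- The lower `s`-density of `μ` at `x`. -/
def lowerDensity {d : ℕ} (μ : Measure (Euc d)) (s : ℝ) (x : Euc d) : ℝ≥0∞ :=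
  liminf (fun r : ℝ => μ (closedBall x r) / ENNReal.ofReal (r ^ s)) (nhdsWithin 0 (Set.Ioi 0))

/-- `μ` is `s`-rectifiable of class `C^{1,α}`: `μ ≪ H^s` and `μ` is carried by countably
many graphs, over `s`-dimensional subspaces, of `C^1` maps with `α`-Hölder derivative. -/
def IsC1alphaRectifiable {d : ℕ} (μ : Measure (Euc d)) (s : ℕ) (α : ℝ≥0) : Prop :=
  μ ≪ μH[(s : ℝ)] ∧
  ∃ F : ℕ → Set (Euc d), μ (⋃ n, F n)ᶜ = 0 ∧
    ∀ n, ∃ (V : Submodule ℝ (Euc d)) (g : ↥V → ↥Vᗮ) (Cg : ℝ≥0),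
      Module.finrank ℝ V = s ∧ ContDiff ℝ 1 g ∧ HolderWith Cg α (fderiv ℝ g) ∧
      F n ⊆ {y : Euc d | ∃ v : ↥V, y = (v : Euc d) + (g v : Euc d)}

open Module Topology

theorem det_adjoint_eq {E : Type*} [NormedAddCommGroup E] [InnerProductSpace ℝ E]
    [FiniteDimensional ℝ E] (A : E →ₗ[ℝ] E) :
    LinearMap.det (LinearMap.adjoint A) = LinearMap.det A := by
  classical
  let b := stdOrthonormalBasis ℝ E
  rw [← LinearMap.det_toMatrix b.toBasis, ← LinearMap.det_toMatrix b.toBasis,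
    LinearMap.toMatrix_adjoint, Matrix.det_conjTranspose, star_trivial]

section ChangeOfVariables

variable {E : Type*} [NormedAddCommGroup E] [InnerProductSpace ℝ E] [FiniteDimensional ℝ E]
  [MeasurableSpace E] [BorelSpace E]

theorem eLpNorm_comp_linearMap {f : E → ℂ} (hf : Continuous f) {A : E →ₗ[ℝ] E}
    (hA : LinearMap.det A ≠ 0) {p : ℝ} (hp : 0 < p) :
    eLpNorm (f ∘ A) (ENNReal.ofReal p) volume =
      ENNReal.ofReal (|LinearMap.det A| ^ (-(1 / p))) * eLpNorm f (ENNReal.ofReal p) volume := by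
  have hAc : Continuous A := A.continuous_of_finiteDimensional
  rw [← eLpNorm_map_measure hf.aestronglyMeasurable hAc.aemeasurable,
    Measure.map_linearMap_addHaar_eq_smul_addHaar _ hA,
    eLpNorm_smul_measure_of_ne_top ENNReal.ofReal_ne_top, smul_eq_mul]
  congr 1
  have h0 : 0 < |LinearMap.det A| := abs_pos.mpr hA
  rw [one_div, ENNReal.toReal_inv, ENNReal.toReal_ofReal hp.le, abs_inv,
    ENNReal.ofReal_rpow_of_pos (inv_pos.mpr h0), Real.inv_rpow h0.le, Real.rpow_neg h0.le, one_div]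

theorem integral_comp_linearMap_add (f : E → ℂ) {A : E ≃L[ℝ] E} (a : E) :
    ∫ y, f y = |LinearMap.det (A : E →ₗ[ℝ] E)| • ∫ z, f (A z + a) := by
  have hinj : Set.InjOn (fun z => A z + a) Set.univ := fun x _ y _ hxy => by simpa using hxy
  have hd : ∀ x ∈ (Set.univ : Set E),
      HasFDerivWithinAt (fun z => A z + a) (A : E →L[ℝ] E) Set.univ x := fun x _ =>
    ((A : E →L[ℝ] E).hasFDerivAt.add_const a).hasFDerivWithinAt
  have hr : (fun z => A z + a) '' Set.univ = Set.univ := by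
    rw [Set.image_univ, Set.range_eq_univ]
    intro y
    exact ⟨A.symm (y - a), by simp⟩
  have key := integral_image_eq_integral_abs_det_fderiv_smul volume MeasurableSet.univ hd hinj f
  rw [hr, Measure.restrict_univ, integral_smul] at key
  exact key

theorem norm_fourierInv_comp_affine (f : E → ℂ) (A : E ≃L[ℝ] E) (a x : E) :
    ‖𝓕⁻ (fun y => f (A.symm (y - a))) x‖ =
      |LinearMap.det (A : E →ₗ[ℝ] E)| * ‖𝓕⁻ f (LinearMap.adjoint (A : E →ₗ[ℝ] E) x)‖ := by
  rw [Real.fourierInv_eq, integral_comp_linearMap_add _ (A := A) a, Real.fourierInv_eq]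
  have : ∀ z : E, Real.fourierChar (inner ℝ (A z + a) x) • f (A.symm (A z + a - a)) =
      Real.fourierChar (inner ℝ a x) •
        (Real.fourierChar (inner ℝ z (LinearMap.adjoint (A : E →ₗ[ℝ] E) x)) • f z) := by
    intro z
    rw [LinearMap.adjoint_inner_right, inner_add_left, add_comm, AddChar.map_add_eq_mul, mul_smul]
    simp
  simp_rw [this, Circle.smul_def (Real.fourierChar (inner ℝ a x))]
  rw [integral_smul, norm_smul, norm_smul, Circle.norm_coe, one_mul, Real.norm_eq_abs, abs_abs]

end ChangeOfVariables

theorem HasRestriction.eLpNorm_affine_le {d : ℕ} {μ : Measure (Euc d)} {p q C : ℝ} (hp : 0 < p)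
    (h : HasRestriction μ p q C) (ψ : 𝓢(Euc d, ℂ)) (A : Euc d ≃L[ℝ] Euc d) (a : Euc d) :
    eLpNorm (fun y => ψ (A.symm (y - a))) (ENNReal.ofReal q) μ ≤
      ENNReal.ofReal C * (ENNReal.ofReal (|LinearMap.det (A : Euc d →ₗ[ℝ] Euc d)| ^ (1 - 1 / p)) *
        eLpNorm (𝓕⁻ ψ : 𝓢(Euc d, ℂ)) (ENNReal.ofReal p) volume) := by
  set D := LinearMap.det (A : Euc d →ₗ[ℝ] Euc d) with hD
  have hD0 : D ≠ 0 := (LinearEquiv.isUnit_det' A.toLinearEquiv).ne_zero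
  let Ψ : 𝓢(Euc d, ℂ) :=
    (SchwartzMap.compCLMOfContinuousLinearEquiv ℂ A.symm ψ).compSubConstCLM ℂ a
  have hΨ : (Ψ : Euc d → ℂ) = fun y => ψ (A.symm (y - a)) := rfl
  have h1 := h (𝓕⁻ Ψ)
  rw [← SchwartzMap.fourier_coe, FourierTransform.fourier_fourierInv_eq, hΨ] at h1
  refine h1.trans ?_
  gcongr
  set B := LinearMap.adjoint (A : Euc d →ₗ[ℝ] Euc d) with hB
  have hBD : LinearMap.det B = D := det_adjoint_eq _
  have h2 : eLpNorm (𝓕⁻ Ψ : 𝓢(Euc d, ℂ)) (ENNReal.ofReal p) volume =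
      eLpNorm (|D| • ((𝓕⁻ ψ : 𝓢(Euc d, ℂ)) ∘ B)) (ENNReal.ofReal p) volume := by
    refine eLpNorm_congr_norm_ae (Eventually.of_forall fun x => ?_)
    rw [SchwartzMap.fourierInv_coe, SchwartzMap.fourierInv_coe, hΨ, norm_fourierInv_comp_affine]
    simp [hD, hB]
  rw [h2, eLpNorm_const_smul, eLpNorm_comp_linearMap (𝓕⁻ ψ : 𝓢(Euc d, ℂ)).continuous
    (by rwa [hBD]) hp, hBD, ← mul_assoc, sub_eq_add_neg,
    Real.rpow_add (abs_pos.mpr hD0), Real.rpow_one, ENNReal.ofReal_mul (abs_nonneg _)]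
  gcongr
  rw [← ofReal_norm, Real.norm_eq_abs, abs_abs]

/-- A nonzero locally finite measure on an `n`-dimensional space has positive lower `n`-density
at some point. -/
theorem exists_eventually_le_measure_closedBall {V : Type*} [NormedAddCommGroup V]
    [InnerProductSpace ℝ V] [FiniteDimensional ℝ V] [MeasurableSpace V] [BorelSpace V]
    (ν : Measure V) [IsLocallyFiniteMeasure ν] (hν : ν ≠ 0) :
    ∃ (x : V) (c : ℝ), 0 < c ∧
      ∀ᶠ r in 𝓝[>] (0 : ℝ), ENNReal.ofReal (c * r ^ finrank ℝ V) ≤ ν (closedBall x r) := by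
  have h1 := Besicovitch.ae_tendsto_rnDeriv (volume : Measure V) ν
  have h2 := Measure.rnDeriv_lt_top (volume : Measure V) ν
  have : (ae ν).NeBot := ae_neBot.mpr hν
  obtain ⟨x, hx1, hx2⟩ := (h1.and h2).exists
  obtain ⟨K, hK1, hK2⟩ := ENNReal.lt_iff_exists_nnreal_btwn.mp hx2
  set b := volume (ball (0 : V) 1) with hb
  have hb0 : b ≠ 0 := (measure_ball_pos _ _ one_pos).ne'
  have hbt : b ≠ ∞ := measure_ball_lt_top.ne
  have hK0 : 0 < (K : ℝ) := by
    have := hK1.pos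
    exact_mod_cast this
  refine ⟨x, b.toReal / K, div_pos (ENNReal.toReal_pos hb0 hbt) hK0, ?_⟩
  filter_upwards [hx1.eventually_lt_const hK1, self_mem_nhdsWithin] with r hr hr0
  have hr0' : 0 < r := hr0
  have hvol := Measure.addHaar_closedBall (volume : Measure V) x hr0'.le
  have hpos : volume (closedBall x r) ≠ 0 := (measure_closedBall_pos _ _ hr0').ne'
  have hle : volume (closedBall x r) ≤ K * ν (closedBall x r) := by
    by_cases ht : ν (closedBall x r) = ∞
    · rw [ht, ENNReal.mul_top (by exact_mod_cast hK0.ne')]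
      exact le_top
    by_cases h0 : ν (closedBall x r) = 0
    · rw [h0, ENNReal.div_zero hpos] at hr
      exact absurd hr not_top_lt
    exact (ENNReal.div_le_iff h0 ht).mp hr.le
  rw [hvol] at hle
  have : ENNReal.ofReal (b.toReal / K * r ^ finrank ℝ V) =
      ENNReal.ofReal (r ^ finrank ℝ V) * b / K := by
    rw [div_mul_eq_mul_div, ENNReal.ofReal_div_of_pos hK0, mul_comm,
      ENNReal.ofReal_mul (by positivity), ENNReal.ofReal_toReal hbt, ENNReal.ofReal_coe_nnreal]
  rw [this]
  exact ENNReal.div_le_of_le_mul' hle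

theorem HolderWith.norm_sub_sub_fderiv_le {V W : Type*} [NormedAddCommGroup V] [NormedSpace ℝ V]
    [NormedAddCommGroup W] [NormedSpace ℝ W] {g : V → W} {K α : ℝ≥0}
    (hg : Differentiable ℝ g) (hH : HolderWith K α (fderiv ℝ g)) {x y : V} {r : ℝ}
    (hr : 0 < r) (hxy : dist y x ≤ r) :
    ‖g y - g x - fderiv ℝ g x (y - x)‖ ≤ K * r ^ (1 + (α : ℝ)) := by
  have hb : ∀ z ∈ closedBall x r, ‖fderiv ℝ g z - fderiv ℝ g x‖ ≤ K * r ^ (α : ℝ) := by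
    intro z hz
    rw [← dist_eq_norm]
    refine (hH.dist_le z x).trans ?_
    gcongr
    exact hz
  refine ((convex_closedBall x r).norm_image_sub_le_of_norm_fderiv_le' (fun z _ => hg z) hb
    (mem_closedBall_self hr.le) hxy).trans ?_
  rw [Real.rpow_add hr, Real.rpow_one, mul_assoc, mul_comm r]
  gcongr
  rwa [← dist_eq_norm]

section Anisotropic

variable {E : Type*} [NormedAddCommGroup E] [InnerProductSpace ℝ E] [FiniteDimensional ℝ E]

/-- The linear automorphism of `E` sending `w + u`, with `w ∈ V` and `u ∈ Vᗮ`, to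
`a • w + (b • u + L (a • w))`. -/
def anisotropicShear (V : Submodule ℝ E) (L : V →ₗ[ℝ] Vᗮ) {a b : ℝ} (ha : a ≠ 0) (hb : b ≠ 0) :
    E ≃ₗ[ℝ] E :=
  let e := V.prodEquivOfIsCompl Vᗮ V.isCompl_orthogonal
  e.symm ≪≫ₗ
    ((LinearEquiv.smulOfNeZero ℝ V a ha).prodCongr (LinearEquiv.smulOfNeZero ℝ Vᗮ b hb) ≪≫ₗ
      (LinearEquiv.refl ℝ V).skewProd (LinearEquiv.refl ℝ Vᗮ) L) ≪≫ₗ e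

theorem anisotropicShear_apply_add (V : Submodule ℝ E) (L : V →ₗ[ℝ] Vᗮ) {a b : ℝ} (ha : a ≠ 0)
    (hb : b ≠ 0) (w : V) (u : Vᗮ) :
    anisotropicShear V L ha hb ((w : E) + (u : E)) =
      ((a • w : V) : E) + ((b • u + L (a • w) : Vᗮ) : E) := by
  have : (w : E) + (u : E) = V.prodEquivOfIsCompl Vᗮ V.isCompl_orthogonal (w, u) := by simp
  rw [this]
  simp [anisotropicShear]

theorem exists_abs_det_anisotropicShear (V : Submodule ℝ E) (L : V →ₗ[ℝ] Vᗮ) :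
    ∃ c : ℝ, 0 < c ∧ ∀ {a b : ℝ} (ha : a ≠ 0) (hb : b ≠ 0),
      |LinearMap.det (anisotropicShear V L ha hb : E →ₗ[ℝ] E)| =
        c * (|a| ^ finrank ℝ V * |b| ^ finrank ℝ Vᗮ) := by
  refine ⟨|LinearMap.det (((LinearEquiv.refl ℝ V).skewProd (LinearEquiv.refl ℝ Vᗮ) L :
    (V × Vᗮ) ≃ₗ[ℝ] (V × Vᗮ)) : (V × Vᗮ) →ₗ[ℝ] (V × Vᗮ))|,
    abs_pos.mpr (LinearEquiv.isUnit_det' _).ne_zero, fun {a b} ha hb => ?_⟩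
  set S := (LinearEquiv.refl ℝ V).skewProd (LinearEquiv.refl ℝ Vᗮ) L
  have : (anisotropicShear V L ha hb : E →ₗ[ℝ] E) =
      (V.prodEquivOfIsCompl Vᗮ V.isCompl_orthogonal : (V × Vᗮ) →ₗ[ℝ] E) ∘ₗ
        ((S : (V × Vᗮ) →ₗ[ℝ] (V × Vᗮ)) ∘ₗ
          LinearMap.prodMap (a • LinearMap.id) (b • LinearMap.id)) ∘ₗ
        (V.prodEquivOfIsCompl Vᗮ V.isCompl_orthogonal).symm := rfl
  rw [this, LinearMap.det_conj, LinearMap.det_comp, LinearMap.det_prodMap, LinearMap.det_smul,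
    LinearMap.det_smul, LinearMap.det_id, LinearMap.det_id, mul_one, mul_one, abs_mul, abs_mul,
    abs_pow, abs_pow]

end Anisotropic

theorem exists_schwartz_eq_one_on_closedBall (d : ℕ) {R : ℝ} (hR : 0 < R) :
    ∃ ψ : 𝓢(Euc d, ℂ), ∀ x ∈ closedBall (0 : Euc d) R, ψ x = 1 := by
  let f : ContDiffBump (0 : Euc d) := ⟨R, R + 1, hR, by linarith⟩
  have hc : HasCompactSupport (fun x => (f x : ℂ)) :=
    f.hasCompactSupport.comp_left (g := fun t : ℝ => (t : ℂ)) Complex.ofReal_zero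
  have hs : ContDiff ℝ (⊤ : ℕ∞) (fun x => (f x : ℂ)) := Complex.ofRealCLM.contDiff.comp f.contDiff
  refine ⟨hc.toSchwartzMap hs, fun x hx => ?_⟩
  have : f x = 1 := f.one_of_mem_closedBall hx
  simp [this]

theorem le_of_eventually_rpow_le {a b c K : ℝ} (hc : 0 < c)
    (h : ∀ᶠ r in 𝓝[>] (0 : ℝ), c * r ^ a ≤ K * r ^ b) : b ≤ a := by
  by_contra! hab
  have h1 : Tendsto (fun r : ℝ => K * r ^ (b - a)) (𝓝[>] 0) (𝓝 (K * 0)) := by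
    refine Tendsto.const_mul K ?_
    have := (Real.continuousAt_rpow_const 0 (b - a) (Or.inr (by linarith))).tendsto
    rw [Real.zero_rpow (by linarith)] at this
    exact this.mono_left nhdsWithin_le_nhds
  rw [mul_zero] at h1
  have h2 : ∀ᶠ r in 𝓝[>] (0 : ℝ), c ≤ K * r ^ (b - a) := by
    filter_upwards [h, self_mem_nhdsWithin] with r hr hr0
    have hr0' : 0 < r := hr0
    rw [Real.rpow_sub hr0', ← mul_div_assoc, le_div_iff₀ (Real.rpow_pos_of_pos hr0' a)]
    exact hr
  exact absurd (ge_of_tendsto h1 h2) (not_le.mpr hc)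

section Graph

variable {E : Type*} [NormedAddCommGroup E] [InnerProductSpace ℝ E]

/-- The graph parametrization `v ↦ v + g v`. -/
def graphMap {V : Submodule ℝ E} (g : V → Vᗮ) (v : V) : E := (v : E) + (g v : E)

theorem continuous_graphMap {V : Submodule ℝ E} {g : V → Vᗮ} (hg : Continuous g) :
    Continuous (graphMap g) :=
  continuous_subtype_val.add (continuous_subtype_val.comp hg)

variable [FiniteDimensional ℝ E]

theorem orthogonalProjectionOnto_graphMap {V : Submodule ℝ E} (g : V → Vᗮ) (v : V) :
    V.orthogonalProjectionOnto (graphMap g v) = v := by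
  simp [graphMap]

theorem isClosed_range_graphMap {V : Submodule ℝ E} {g : V → Vᗮ} (hg : Continuous g) :
    IsClosed (Set.range (graphMap g)) := by
  have : Set.range (graphMap g) = {y | graphMap g (V.orthogonalProjectionOnto y) = y} := by
    ext y
    constructor
    · rintro ⟨v, rfl⟩
      simp [orthogonalProjectionOnto_graphMap]
    · intro hy
      exact ⟨_, hy⟩
  rw [this]
  exact isClosed_eq ((continuous_graphMap hg).comp (ContinuousLinearMap.continuous _)) continuous_id

/-- A locally finite measure charging a graph over `V` has positive lower density, of order
`dim V`, along the graph at some point. -/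
theorem exists_eventually_le_measure_graphMap_image [MeasurableSpace E] [BorelSpace E]
    (μ : Measure E) [IsLocallyFiniteMeasure μ] {V : Submodule ℝ E} {g : V → Vᗮ}
    (hg : Continuous g) (hμ : μ (Set.range (graphMap g)) ≠ 0) :
    ∃ (x : V) (c : ℝ), 0 < c ∧ ∀ᶠ r in 𝓝[>] (0 : ℝ),
      ENNReal.ofReal (c * r ^ finrank ℝ V) ≤ μ (graphMap g '' closedBall x r) := by
  have hP : Measurable V.orthogonalProjectionOnto :=
    (ContinuousLinearMap.continuous _).measurable
  set ν : Measure V := (μ.restrict (Set.range (graphMap g))).map V.orthogonalProjectionOnto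
  have hνS : ∀ S : Set V, MeasurableSet S → ν S = μ (graphMap g '' S) := by
    intro S hS
    rw [Measure.map_apply hP hS, Measure.restrict_apply (hP hS)]
    congr 1
    ext y
    constructor
    · rintro ⟨hy, v, rfl⟩
      rw [Set.mem_preimage, orthogonalProjectionOnto_graphMap] at hy
      exact ⟨v, hy, rfl⟩
    · rintro ⟨v, hv, rfl⟩
      refine ⟨?_, v, rfl⟩
      rwa [Set.mem_preimage, orthogonalProjectionOnto_graphMap]
  have : IsLocallyFiniteMeasure ν := ⟨fun x => ⟨closedBall x 1, closedBall_mem_nhds x one_pos, by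
    rw [hνS _ measurableSet_closedBall]
    exact ((isCompact_closedBall x 1).image (continuous_graphMap hg)).measure_lt_top⟩⟩
  have hν : ν ≠ 0 := by
    intro h0
    apply hμ
    rw [← Set.image_univ, ← hνS _ MeasurableSet.univ, h0]
    simp
  obtain ⟨x, c, hc, h⟩ := exists_eventually_le_measure_closedBall ν hν
  refine ⟨x, c, hc, h.mono fun r hr => ?_⟩
  rwa [hνS _ measurableSet_closedBall] at hr

theorem norm_anisotropicShear_symm_graphMap_sub_le {V : Submodule ℝ E} {g : V → Vᗮ} {K α : ℝ≥0}
    (hg : Differentiable ℝ g) (hH : HolderWith K α (fderiv ℝ g)) {x v : V} {r : ℝ} (hr : 0 < r)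
    (hv : v ∈ closedBall x r) :
    ‖(anisotropicShear V (fderiv ℝ g x : V →ₗ[ℝ] Vᗮ) hr.ne'
        (Real.rpow_pos_of_pos hr (1 + (α : ℝ))).ne').symm (graphMap g v - graphMap g x)‖
      ≤ 1 + K := by
  set b := r ^ (1 + (α : ℝ)) with hb
  have hb0 : 0 < b := Real.rpow_pos_of_pos hr _
  set u : Vᗮ := g v - g x - fderiv ℝ g x (v - x) with hu
  have hub : ‖u‖ ≤ K * b := hH.norm_sub_sub_fderiv_le hg hr hv
  have hvx : ‖v - x‖ ≤ r := by rwa [← dist_eq_norm]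
  have key : graphMap g v - graphMap g x =
      anisotropicShear V (fderiv ℝ g x : V →ₗ[ℝ] Vᗮ) hr.ne' hb0.ne'
        (((r⁻¹ • (v - x) : V) : E) + ((b⁻¹ • u : Vᗮ) : E)) := by
    rw [anisotropicShear_apply_add, smul_inv_smul₀ hr.ne', smul_inv_smul₀ hb0.ne', hu]
    simp only [graphMap, ContinuousLinearMap.coe_coe, sub_add_cancel, Submodule.coe_sub]
    abel
  rw [key, LinearEquiv.symm_apply_apply]
  refine (norm_add_le _ _).trans (add_le_add ?_ ?_)
  · rw [← Submodule.coe_norm, norm_smul, norm_inv, Real.norm_of_nonneg hr.le, inv_mul_le_iff₀ hr,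
      mul_one]
    exact hvx
  · rw [← Submodule.coe_norm, norm_smul, norm_inv, Real.norm_of_nonneg hb0.le, inv_mul_le_iff₀ hb0,
      mul_comm]
    exact hub

/-- A `C^{1,α}` graph over a ball of radius `r` lies in an affine image of a fixed ball, of size
`r` along the tangent space and `r^{1+α}` across it. -/
theorem exists_linearEquiv_norm_symm_graphMap_sub_le {V : Submodule ℝ E} {g : V → Vᗮ} {K α : ℝ≥0}
    (hg : Differentiable ℝ g) (hH : HolderWith K α (fderiv ℝ g)) (x : V) :
    ∃ c : ℝ, 0 < c ∧ ∀ r : ℝ, 0 < r → ∃ A : E ≃L[ℝ] E,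
      |LinearMap.det (A : E →ₗ[ℝ] E)| = c * r ^ (finrank ℝ V + (1 + (α : ℝ)) * finrank ℝ Vᗮ) ∧
      ∀ v ∈ closedBall x r, ‖A.symm (graphMap g v - graphMap g x)‖ ≤ 1 + K := by
  obtain ⟨c, hc, hdet⟩ := exists_abs_det_anisotropicShear V (fderiv ℝ g x : V →ₗ[ℝ] Vᗮ)
  refine ⟨c, hc, fun r hr => ⟨(anisotropicShear V (fderiv ℝ g x : V →ₗ[ℝ] Vᗮ) hr.ne'
    (Real.rpow_pos_of_pos hr (1 + (α : ℝ))).ne').toContinuousLinearEquiv, ?_,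
    fun v hv => norm_anisotropicShear_symm_graphMap_sub_le hg hH hr hv⟩⟩
  refine (hdet hr.ne' (Real.rpow_pos_of_pos hr (1 + (α : ℝ))).ne').trans ?_
  rw [abs_of_pos hr, abs_of_pos (Real.rpow_pos_of_pos hr _),
    Real.rpow_add hr (finrank ℝ V), Real.rpow_natCast, Real.rpow_mul hr.le, Real.rpow_natCast]

end Graph

theorem measure_rpow_le_eLpNorm {X : Type*} [MeasurableSpace X] {μ : Measure X} {f : X → ℂ}
    (hf : AEStronglyMeasurable f μ) {q : ℝ} (hq : 0 < q) {S : Set X} (hS : ∀ x ∈ S, f x = 1) :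
    μ S ^ (1 / q) ≤ eLpNorm f (ENNReal.ofReal q) μ := by
  have h := mul_meas_ge_le_pow_eLpNorm' μ (p := ENNReal.ofReal q) (by simpa using hq)
    ENNReal.ofReal_ne_top hf 1
  rw [ENNReal.one_rpow, one_mul, ENNReal.toReal_ofReal hq.le] at h
  rw [one_div, ENNReal.rpow_inv_le_iff hq]
  refine (measure_mono fun x hx => ?_).trans h
  simp [hS x hx]

theorem toReal_mul_rpow_le_of_ofReal_rpow_le {r c c₀ t u D C : ℝ} {m : ℕ} {N : ℝ≥0∞} (hr : 0 < r) (hc : 0 < c)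
    (hc₀ : 0 < c₀) (hu : 0 ≤ u) (hN : N ≠ ∞)
    (h : ENNReal.ofReal (c * r ^ m) ^ u ≤
      ENNReal.ofReal C * (ENNReal.ofReal ((c₀ * r ^ D) ^ t) * N)) :
    c ^ u * r ^ (m * u) ≤ (ENNReal.ofReal C).toReal * (c₀ ^ t * N.toReal) * r ^ (D * t) := by
  have hfin : ENNReal.ofReal C * (ENNReal.ofReal ((c₀ * r ^ D) ^ t) * N) ≠ ∞ :=
    ENNReal.mul_ne_top ENNReal.ofReal_ne_top (ENNReal.mul_ne_top ENNReal.ofReal_ne_top hN)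
  rw [ENNReal.ofReal_rpow_of_nonneg (by positivity) hu] at h
  have hreal := (ENNReal.ofReal_le_iff_le_toReal hfin).mp h
  have ht : 0 ≤ (c₀ * r ^ D) ^ t := by positivity
  rw [ENNReal.toReal_mul, ENNReal.toReal_mul, ENNReal.toReal_ofReal ht,
    Real.mul_rpow hc.le (by positivity), Real.mul_rpow hc₀.le (by positivity),
    ← Real.rpow_mul hr.le, ← Real.rpow_natCast, ← Real.rpow_mul hr.le] at hreal
  refine hreal.trans (le_of_eq ?_)
  ring

theorem le_rpow_exponent_of_graph {d : ℕ} {μ : Measure (Euc d)} [IsLocallyFiniteMeasure μ]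
    {V : Submodule ℝ (Euc d)} {g : V → Vᗮ} {K α : ℝ≥0} (hg : ContDiff ℝ 1 g)
    (hH : HolderWith K α (fderiv ℝ g)) (hμ : μ (Set.range (graphMap g)) ≠ 0)
    {p q C : ℝ} (hp : 0 < p) (hq : 0 < q) (h : HasRestriction μ p q C) :
    (finrank ℝ V + (1 + (α : ℝ)) * finrank ℝ Vᗮ) * (1 - 1 / p) ≤ finrank ℝ V * (1 / q) := by
  obtain ⟨x, c, hc, hx⟩ := exists_eventually_le_measure_graphMap_image μ hg.continuous hμ
  obtain ⟨ψ, hψ⟩ := exists_schwartz_eq_one_on_closedBall d (R := 1 + K) (by positivity)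
  obtain ⟨c₀, hc₀, hbox⟩ := exists_linearEquiv_norm_symm_graphMap_sub_le
    (hg.differentiable one_ne_zero) hH x
  set N := eLpNorm (𝓕⁻ ψ : 𝓢(Euc d, ℂ)) (ENNReal.ofReal p) volume with hN
  have hNt : N ≠ ∞ := ((𝓕⁻ ψ : 𝓢(Euc d, ℂ)).memLp (ENNReal.ofReal p) volume).eLpNorm_ne_top
  refine le_of_eventually_rpow_le (c := c ^ (1 / q))
    (K := (ENNReal.ofReal C).toReal * (c₀ ^ (1 - 1 / p) * N.toReal))
    (Real.rpow_pos_of_pos hc _) ?_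
  filter_upwards [hx, self_mem_nhdsWithin] with r hr hr0
  have hr0' : 0 < r := hr0
  obtain ⟨A, hAdet, hAnorm⟩ := hbox r hr0'
  have hup := h.eLpNorm_affine_le hp ψ A (graphMap g x)
  have hlow : μ (graphMap g '' closedBall x r) ^ (1 / q) ≤
      eLpNorm (fun y => ψ (A.symm (y - graphMap g x))) (ENNReal.ofReal q) μ := by
    have hcont : Continuous fun y => ψ (A.symm (y - graphMap g x)) :=
      ψ.continuous.comp (by fun_prop)
    refine measure_rpow_le_eLpNorm hcont.aestronglyMeasurable hq ?_
    rintro y ⟨v, hv, rfl⟩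
    exact hψ _ (mem_closedBall_zero_iff.mpr (hAnorm v hv))
  have htot := ((ENNReal.rpow_le_rpow hr (by positivity : 0 ≤ 1 / q)).trans hlow).trans hup
  rw [hAdet] at htot
  exact toReal_mul_rpow_le_of_ofReal_rpow_le hr0' hc hc₀ (by positivity) hNt htot

/-- Knapp-type necessary condition for rectifiable measures: if `μ` is `s`-rectifiable of
class `C^{1,α}` with `0 < Θ^s_*(μ,ξ₀) ≤ Θ^{*s}(μ,ξ₀) < ∞` at some point `ξ₀`, and `μ`
admits `(p,q)` Fourier restriction, then `q ≤ s p' / (d + α(d-s))`. -/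
theorem restriction_exponent_of_C1alpha_rectifiable (d s : ℕ) (hs0 : 0 < s) (hsd : s < d)
    (α : ℝ≥0) (hα0 : 0 < α) (hα1 : α ≤ 1)
    (μ : Measure (Euc d)) [IsLocallyFiniteMeasure μ]
    (hrect : IsC1alphaRectifiable μ s α) (ξ₀ : Euc d)
    (hl : 0 < lowerDensity μ s ξ₀) (hu : upperDensity μ s ξ₀ < ∞)
    (p q C : ℝ) (hp : 1 < p) (hq : 1 ≤ q) (h : HasRestriction μ p q C) :
    q ≤ (s : ℝ) * (p / (p - 1)) / ((d : ℝ) + (α : ℝ) * ((d : ℝ) - (s : ℝ))) := by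
  obtain ⟨-, F, hF, hgraph⟩ := hrect
  choose V g K hV hg hH hFg using hgraph
  have hμ0 : μ ≠ 0 := by
    rintro rfl
    simp [lowerDensity] at hl
  obtain ⟨n, hn⟩ : ∃ n, μ (Set.range (graphMap (g n))) ≠ 0 := by
    by_contra! hall
    apply hμ0
    rw [← Measure.measure_univ_eq_zero, ← Set.union_compl_self (⋃ n, F n)]
    refine measure_union_null (measure_iUnion_null fun n => measure_mono_null ?_ (hall n)) hF
    intro y hy
    obtain ⟨v, hv⟩ := hFg n hy
    exact ⟨v, hv.symm⟩
  have hq0 : 0 < q := by linarith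
  have hp0 : 0 < p := by linarith
  have hp1 : 0 < p - 1 := by linarith
  have key := le_rpow_exponent_of_graph (hg n) (hH n) hn hp0 hq0 h
  have hrank : (finrank ℝ (V n)ᗮ : ℝ) = d - s := by
    have := (V n).finrank_add_finrank_orthogonal
    rw [finrank_euclideanSpace_fin, hV n] at this
    rw [eq_sub_iff_add_eq', ← Nat.cast_add, this]
  rw [hV n, hrank] at key
  have hds : (0 : ℝ) < d - s := sub_pos.mpr (by exact_mod_cast hsd)
  have hD : 0 < (d : ℝ) + (α : ℝ) * ((d : ℝ) - (s : ℝ)) := by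
    have : (0 : ℝ) < d := by exact_mod_cast hs0.trans hsd
    positivity
  have h1 : 1 - 1 / p = (p - 1) / p := by field_simp
  rw [h1, mul_one_div, mul_div_assoc', div_le_div_iff₀ hp0 hq0] at key
  rw [le_div_iff₀ hD, mul_div_assoc', le_div_iff₀ hp1]
  refine le_of_eq_of_le ?_ key
  ring

end
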